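/- Let G be an abelian group and let A, B ⊆ G be finite and nonempty with |A|, |B| ≥ 2. Then either (i) |A +_1 B| + |A +_2 B| ≥ 2|A| + 2|B| − 4, or else (ii) there exist subsets A' ⊆ A and B' ⊆ B such that, setting l := |A \ A'| + |B \ B'|, H := H(A +_2 B) the stabilizer of A +_2 B, and ρ := |A'+H| − |A'| + |B'+H| − |B'|, one has: l ≤ 1; A' +_2 B' = A' + B' = A +_2 B; H is nontrivial; and |A +_1 B| + |A +_2 B| ≥ 2|A| + 2|B| − (2−l)(|H|−ρ) − 2l ≥ 2|A| + 2|B| − 2|H|. -/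

import Mathlib

open scoped Pointwise

variable {G : Type*} [AddCommGroup G] [DecidableEq G]

/-- `rep A B g` is the number of representations of `g` as `a + b` with `a ∈ A`, `b ∈ B`. -/
def rep (A B : Finset G) (g : G) : ℕ :=
  ((A ×ˢ B).filter (fun p => p.1 + p.2 = g)).card

/-- `repSum A B i` is the set `A +_i B` of elements having at least `i` representations. -/
def repSum (A B : Finset G) (i : ℕ) : Finset G :=
  (A + B).filter (fun g => i ≤ rep A B g)

/-- the stabilizer `H(S) = {x : G | x + S = S}` of a finite subset `S`. -/
def stab (S : Finset G) : AddSubgroup G := AddAction.stabilizer G S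

/-! ### The stabilizer of a finite set -/

theorem mem_stab_iff {S : Finset G} {x : G} : x ∈ stab S ↔ ∀ s ∈ S, x + s ∈ S :=
  AddAction.mem_stabilizer_finset'

/-- The stabilizer of a nonempty finite set, as a finite set. -/
def stabFinset (S : Finset G) : Finset G :=
  (S - S).filter (fun x => ∀ s ∈ S, x + s ∈ S)

theorem mem_stabFinset {S : Finset G} (hS : S.Nonempty) {x : G} :
    x ∈ stabFinset S ↔ x ∈ stab S := by
  rw [stabFinset, Finset.mem_filter, mem_stab_iff, and_iff_right_iff_imp]
  intro h
  obtain ⟨s, hs⟩ := hS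
  exact Finset.mem_sub.2 ⟨x + s, h s hs, s, hs, by abel⟩

theorem coe_stabFinset {S : Finset G} (hS : S.Nonempty) :
    (stabFinset S : Set G) = (stab S : Set G) := by
  ext x
  simpa using mem_stabFinset hS

theorem natCard_stab {S : Finset G} (hS : S.Nonempty) :
    Nat.card (stab S) = (stabFinset S).card := by
  have h : Nat.card (stab S) = (stab S : Set G).ncard := rfl
  rw [h, ← coe_stabFinset hS, Set.ncard_coe_finset]

theorem zero_mem_stabFinset {S : Finset G} (hS : S.Nonempty) : 0 ∈ stabFinset S :=
  (mem_stabFinset hS).2 (zero_mem _)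

theorem add_add_stabFinset {A B : Finset G} (hA : A.Nonempty) (hB : B.Nonempty) :
    A + B + stabFinset (A + B) = A + B := by
  ext x
  constructor
  · intro hx
    obtain ⟨c, hc, h, hh, rfl⟩ := Finset.mem_add.1 hx
    rw [add_comm c]
    exact mem_stab_iff.1 ((mem_stabFinset (hA.add hB)).1 hh) c hc
  · intro hx
    exact Finset.mem_add.2 ⟨x, hx, 0, zero_mem_stabFinset (hA.add hB), add_zero x⟩

/-! ### Kneser's theorem -/

theorem card_mul_card_le_of_subgroups {H K : AddSubgroup G} {U V T L : Finset G} (c : G)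
    (hU : ∀ u ∈ U, u ∈ H) (hV : ∀ v ∈ V, v ∈ K) (hL : ∀ x, x ∈ H → x ∈ K → x ∈ L)
    (hT : ∀ u ∈ U, ∀ v ∈ V, c + u + v ∈ T) : U.card * V.card ≤ L.card * T.card := by
  rw [← Finset.card_product]
  refine Finset.card_le_mul_card_image_of_maps_to (f := fun p : G × G => c + p.1 + p.2)
    (fun p hp => hT _ (Finset.mem_product.1 hp).1 _ (Finset.mem_product.1 hp).2) _ ?_
  intro t _
  rcases (Finset.filter (fun p : G × G => c + p.1 + p.2 = t) (U ×ˢ V)).eq_empty_or_nonempty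
    with h | ⟨⟨u₀, v₀⟩, h⟩
  · simp [h]
  · simp only [Finset.mem_filter, Finset.mem_product] at h
    obtain ⟨⟨hu₀, hv₀⟩, rfl⟩ := h
    refine Finset.card_le_card_of_injOn (fun p => p.1 - u₀) ?_ ?_
    · rintro ⟨u, v⟩ hp
      simp only [Finset.coe_filter, Finset.mem_product, Set.mem_ofPred_eq] at hp
      obtain ⟨⟨hu, hv⟩, h⟩ := hp
      refine hL _ (H.sub_mem (hU u hu) (hU u₀ hu₀)) ?_
      have h' : u - u₀ = v₀ - v := by
        rw [add_assoc, add_assoc, add_right_inj] at h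
        rw [sub_eq_sub_iff_add_eq_add, h, add_comm]
      simp only [h']
      exact K.sub_mem (hV v₀ hv₀) (hV v hv)
    · rintro ⟨u, v⟩ hp ⟨u', v'⟩ hp' h
      simp only [Finset.coe_filter, Finset.mem_product, Set.mem_ofPred_eq] at hp hp'
      have h1 : u = u' := by simpa using h
      subst h1
      have h2 := hp.2.trans hp'.2.symm
      rw [add_right_inj] at h2
      rw [h2]

theorem grid_arith {h u v m n p q : ℕ} (hu : h ≤ u) (hv : h ≤ v) (hum : u ≤ m)
    (hvn : v ≤ n) (hum' : u = m ∨ h ≤ m - u) (hvn' : v = n ∨ h ≤ n - v) (hpos : 0 < h)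
    (hp : u * v ≤ h * p) (hq : (m - u) * (n - v) ≤ h * q) :
    m ≤ p + h ∨ n ≤ q + h ∨ n ≤ p := by
  rcases hum' with rfl | hum'
  · left
    have : h * u ≤ h * p := by nlinarith
    have := Nat.le_of_mul_le_mul_left this hpos
    omega
  rcases hvn' with rfl | hvn'
  · right; right
    have : h * v ≤ h * p := by nlinarith
    exact Nat.le_of_mul_le_mul_left this hpos
  by_contra! hcon
  obtain ⟨h1, h2, -⟩ := hcon
  obtain ⟨m', rfl⟩ := Nat.exists_eq_add_of_le hum
  obtain ⟨n', rfl⟩ := Nat.exists_eq_add_of_le hvn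
  simp only [Nat.add_sub_cancel_left] at hum' hvn' hq
  obtain ⟨a, rfl⟩ := Nat.exists_eq_add_of_le hu
  obtain ⟨b, rfl⟩ := Nat.exists_eq_add_of_le hv
  obtain ⟨a', rfl⟩ := Nat.exists_eq_add_of_le hum'
  obtain ⟨b', rfl⟩ := Nat.exists_eq_add_of_le hvn'
  have h1' : p < h + a + a' := by omega
  have h2' : q < h + b + b' := by omega
  have hP : (h + a) * (h + b) * ((h + a') * (h + b')) ≤ h * p * (h * q) :=
    Nat.mul_le_mul hp hq
  have hA : h * (h + a + a') ≤ (h + a) * (h + a') := by nlinarith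
  have hB : h * (h + b + b') ≤ (h + b) * (h + b') := by nlinarith
  have hAB := Nat.mul_le_mul hA hB
  have hlt : h * p * (h * q) < h * (h + a + a') * (h * (h + b + b')) :=
    Nat.mul_lt_mul'' (Nat.mul_lt_mul_of_pos_left h1' hpos) (Nat.mul_lt_mul_of_pos_left h2' hpos)
  have heq : (h + a) * (h + b) * ((h + a') * (h + b'))
      = (h + a) * (h + a') * ((h + b) * (h + b')) := by ring
  omega

theorem sdiff_card_alternatives {C D : Finset G} (hC : C.Nonempty) (hD : D.Nonempty)
    (hCD : (C \ D).Nonempty) :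
    (stabFinset D).card ≤ (C \ D).card + (stabFinset C ∩ stabFinset D).card ∨
    (stabFinset C).card ≤ (D \ C).card + (stabFinset C ∩ stabFinset D).card ∨
    (stabFinset C).card ≤ (C \ D).card := by
  obtain ⟨c, hc⟩ := hCD
  rw [Finset.mem_sdiff] at hc
  have memC : ∀ {x y : G}, x ∈ stabFinset C → (x + y ∈ C ↔ y ∈ C) := fun hx =>
    AddAction.mem_stabilizer_finset.1 ((mem_stabFinset hC).1 hx) _
  have memD : ∀ {x y : G}, x ∈ stabFinset D → (x + y ∈ D ↔ y ∈ D) := fun hx =>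
    AddAction.mem_stabilizer_finset.1 ((mem_stabFinset hD).1 hx) _
  have addC : ∀ {x y : G}, x ∈ stabFinset C → y ∈ stabFinset C → x + y ∈ stabFinset C := by
    intro x y hx hy
    rw [mem_stabFinset hC] at *
    exact add_mem hx hy
  have addD : ∀ {x y : G}, x ∈ stabFinset D → y ∈ stabFinset D → x + y ∈ stabFinset D := by
    intro x y hx hy
    rw [mem_stabFinset hD] at *
    exact add_mem hx hy
  set U := (stabFinset D).filter (fun x => c + x ∈ C) with hU
  set V := (stabFinset C).filter (fun x => c + x ∉ D) with hV
  set L := stabFinset C ∩ stabFinset D with hL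
  have hLU : L ⊆ U := by
    intro x hx
    rw [hL, Finset.mem_inter] at hx
    rw [hU, Finset.mem_filter, add_comm, memC hx.1]
    exact ⟨hx.2, hc.1⟩
  have hLV : L ⊆ V := by
    intro x hx
    rw [hL, Finset.mem_inter] at hx
    rw [hV, Finset.mem_filter, add_comm, memD hx.2]
    exact ⟨hx.1, hc.2⟩
  have hUs : U ⊆ stabFinset D := Finset.filter_subset _ _
  have hVs : V ⊆ stabFinset C := Finset.filter_subset _ _
  have hLpos : 0 < L.card := Finset.card_pos.2
    ⟨0, Finset.mem_inter.2 ⟨zero_mem_stabFinset hC, zero_mem_stabFinset hD⟩⟩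
  have hsU : (stabFinset D \ U).card = (stabFinset D).card - U.card :=
    Finset.card_sdiff_of_subset hUs
  have hsV : (stabFinset C \ V).card = (stabFinset C).card - V.card :=
    Finset.card_sdiff_of_subset hVs
  refine grid_arith (Finset.card_le_card hLU) (Finset.card_le_card hLV)
    (Finset.card_le_card hUs) (Finset.card_le_card hVs) ?_ ?_ hLpos ?_ ?_
  · rw [← hsU]
    rcases (stabFinset D \ U).eq_empty_or_nonempty with h | ⟨x, hx⟩
    · left
      exact le_antisymm (Finset.card_le_card hUs)
        (Finset.card_le_card (Finset.sdiff_eq_empty_iff_subset.1 h))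
    · right
      refine Finset.card_le_card_of_injOn (fun y => y + x) ?_
        (fun y _ z _ h => add_right_cancel h)
      intro y hy
      have hy' := Finset.mem_inter.1 (Finset.mem_coe.1 hy)
      simp only [hU, Finset.mem_sdiff, Finset.mem_filter, not_and] at hx
      simp only [hU, Finset.coe_sdiff, Finset.coe_filter, Set.mem_sdiff, Finset.mem_coe,
        Set.mem_ofPred_eq, not_and]
      refine ⟨addD hy'.2 hx.1, fun _ h => hx.2 hx.1 ?_⟩
      rwa [add_left_comm, memC hy'.1] at h
  · rw [← hsV]
    rcases (stabFinset C \ V).eq_empty_or_nonempty with h | ⟨x, hx⟩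
    · left
      exact le_antisymm (Finset.card_le_card hVs)
        (Finset.card_le_card (Finset.sdiff_eq_empty_iff_subset.1 h))
    · right
      refine Finset.card_le_card_of_injOn (fun y => y + x) ?_
        (fun y _ z _ h => add_right_cancel h)
      intro y hy
      have hy' := Finset.mem_inter.1 (Finset.mem_coe.1 hy)
      simp only [hV, Finset.mem_sdiff, Finset.mem_filter, not_and] at hx
      simp only [hV, Finset.coe_sdiff, Finset.coe_filter, Set.mem_sdiff, Finset.mem_coe,
        Set.mem_ofPred_eq, not_and]
      refine ⟨addC hy'.1 hx.1, fun _ h => hx.2 hx.1 ?_⟩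
      rwa [add_left_comm, memD hy'.2] at h
  · refine card_mul_card_le_of_subgroups (H := stab D) (K := stab C) c
      (fun u hu => (mem_stabFinset hD).1 (hUs hu)) (fun v hv => (mem_stabFinset hC).1 (hVs hv))
      (fun x hx hy => Finset.mem_inter.2 ⟨(mem_stabFinset hC).2 hy, (mem_stabFinset hD).2 hx⟩) ?_
    intro u hu v hv
    rw [hU, Finset.mem_filter] at hu
    rw [hV, Finset.mem_filter] at hv
    rw [Finset.mem_sdiff]
    constructor
    · rw [add_comm, memC hv.1]; exact hu.2
    · rw [add_right_comm, add_comm, memD hu.1]; exact hv.2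
  · rw [← hsU, ← hsV]
    refine card_mul_card_le_of_subgroups (H := stab D) (K := stab C) c
      (fun u hu => (mem_stabFinset hD).1 (Finset.sdiff_subset hu))
      (fun v hv => (mem_stabFinset hC).1 (Finset.sdiff_subset hv))
      (fun x hx hy => Finset.mem_inter.2 ⟨(mem_stabFinset hC).2 hy, (mem_stabFinset hD).2 hx⟩) ?_
    intro u hu v hv
    simp only [hU, Finset.mem_sdiff, Finset.mem_filter, not_and] at hu
    simp only [hV, Finset.mem_sdiff, Finset.mem_filter, not_and, not_not] at hv
    rw [Finset.mem_sdiff]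
    constructor
    · rw [add_right_comm, add_comm, memD hu.1]; exact hv.2 hv.1
    · rw [add_comm, memC hv.1]; exact hu.2 hu.1

theorem le_card_union_add_card_stab {C D : Finset G} (hC : C.Nonempty) (hD : D.Nonempty) {k : ℕ}
    (hCk : k ≤ C.card + (stabFinset C).card) (hDk : k ≤ D.card + (stabFinset D).card) :
    k ≤ (C ∪ D).card + (stabFinset (C ∪ D)).card := by
  rcases (C \ D).eq_empty_or_nonempty with h | hCD
  · rwa [Finset.union_eq_right.2 (Finset.sdiff_eq_empty_iff_subset.1 h)]
  rcases (D \ C).eq_empty_or_nonempty with h | hDC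
  · rwa [Finset.union_eq_left.2 (Finset.sdiff_eq_empty_iff_subset.1 h)]
  have h1 := sdiff_card_alternatives hC hD hCD
  have h2 := sdiff_card_alternatives hD hC hDC
  rw [Finset.inter_comm (stabFinset D)] at h2
  have h3 : (C ∪ D).card = (C \ D).card + D.card := (Finset.card_sdiff_add_card C D).symm
  have h4 : (C ∪ D).card = (D \ C).card + C.card := by
    rw [Finset.union_comm]; exact (Finset.card_sdiff_add_card D C).symm
  have h5 : (stabFinset C ∩ stabFinset D).card ≤ (stabFinset (C ∪ D)).card := by
    refine Finset.card_le_card fun x hx => ?_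
    rw [Finset.mem_inter, mem_stabFinset hC, mem_stabFinset hD, mem_stab_iff, mem_stab_iff] at hx
    rw [mem_stabFinset (hC.mono Finset.subset_union_left), mem_stab_iff]
    intro s hs
    rcases Finset.mem_union.1 hs with hs | hs
    · exact Finset.mem_union_left _ (hx.1 s hs)
    · exact Finset.mem_union_right _ (hx.2 s hs)
  omega

theorem le_card_add_card_stab_of_cover {ι : Type*} {S : Finset G} {k : ℕ} (s : Finset ι)
    (hs : s.Nonempty) (f : ι → Finset G)
    (hf : ∀ i ∈ s, (f i).Nonempty ∧ k ≤ (f i).card + (stabFinset (f i)).card)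
    (hS : S = s.biUnion f) : k ≤ S.card + (stabFinset S).card := by
  classical
  subst hS
  induction hs using Finset.Nonempty.cons_induction with
  | singleton a => simpa using (hf a (by simp)).2
  | cons a s ha hs ih =>
    rw [Finset.cons_eq_insert, Finset.biUnion_insert]
    obtain ⟨i, hi⟩ := hs
    have hne : (s.biUnion f).Nonempty := by
      obtain ⟨x, hx⟩ := (hf i (Finset.mem_cons_of_mem hi)).1
      exact ⟨x, Finset.mem_biUnion.2 ⟨i, hi, hx⟩⟩
    exact le_card_union_add_card_stab (hf a (Finset.mem_cons_self a s)).1 hne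
      (hf a (Finset.mem_cons_self a s)).2 (ih fun j hj => hf j (Finset.mem_cons_of_mem hj))

theorem dyson_card (A B : Finset G) (e : G) :
    (A ∪ B.image (e + ·)).card + (B.filter (fun b => e + b ∈ A)).card = A.card + B.card := by
  have h1 := Finset.card_union_add_card_inter A (B.image (e + ·))
  rw [Finset.card_image_of_injective _ (add_right_injective e)] at h1
  have h2 : A ∩ B.image (e + ·) = (B.filter (fun b => e + b ∈ A)).image (e + ·) := by
    ext x
    simp only [Finset.mem_inter, Finset.mem_image, Finset.mem_filter]
    constructor
    · rintro ⟨hx, b, hb, rfl⟩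
      exact ⟨b, ⟨hb, hx⟩, rfl⟩
    · rintro ⟨b, ⟨hb, hx⟩, rfl⟩
      exact ⟨hx, b, hb, rfl⟩
  rw [h2, Finset.card_image_of_injective _ (add_right_injective e)] at h1
  exact h1

/-- Kneser's theorem, in the form `|A| + |B| ≤ |A + B| + |H(A + B)|`. -/
theorem card_add_card_le_card_add_add_card_stab {A B : Finset G} (hA : A.Nonempty)
    (hB : B.Nonempty) : A.card + B.card ≤ (A + B).card + (stabFinset (A + B)).card := by
  induction hn : B.card using Nat.strong_induction_on generalizing A B with
  | _ n ih =>
  subst hn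
  by_cases hcl : ∃ b₀ ∈ B, ∀ a ∈ A, ∀ b ∈ B, a - b₀ + b ∈ A
  · obtain ⟨b₀, hb₀, hcl⟩ := hcl
    have h1 : A + B = A.image (b₀ + ·) := by
      ext x
      simp only [Finset.mem_add, Finset.mem_image]
      constructor
      · rintro ⟨a, ha, b, hb, rfl⟩
        exact ⟨a - b₀ + b, hcl a ha b hb, by abel⟩
      · rintro ⟨a, ha, rfl⟩
        exact ⟨a, ha, b₀, hb₀, add_comm _ _⟩
    have h2 : (A + B).card = A.card := by
      rw [h1, Finset.card_image_of_injective _ (add_right_injective b₀)]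
    have h3 : B.card ≤ (stabFinset (A + B)).card := by
      refine Finset.card_le_card_of_injOn (fun b => b - b₀) ?_
        (fun y _ z _ h => sub_left_injective h)
      intro b hb
      rw [Finset.mem_coe, mem_stabFinset (hA.add hB), mem_stab_iff]
      intro s hs
      rw [h1, Finset.mem_image] at hs ⊢
      obtain ⟨a, ha, rfl⟩ := hs
      exact ⟨a - b₀ + b, hcl a ha b hb, by beta_reduce; abel⟩
    omega
  · push Not at hcl
    choose! f hfA g hgB hfg using hcl
    refine le_card_add_card_stab_of_cover B hB
      (fun b₀ => (A ∪ B.image (f b₀ - b₀ + ·)) + B.filter (fun b => f b₀ - b₀ + b ∈ A)) ?_ ?_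
    · intro b₀ hb₀
      have hmem : b₀ ∈ B.filter (fun b => f b₀ - b₀ + b ∈ A) := by
        simp [hb₀, hfA b₀ hb₀]
      have hne1 : (A ∪ B.image (f b₀ - b₀ + ·)).Nonempty := hA.mono Finset.subset_union_left
      refine ⟨hne1.add ⟨b₀, hmem⟩, ?_⟩
      rw [← dyson_card A B (f b₀ - b₀)]
      refine ih _ ?_ hne1 ⟨b₀, hmem⟩ rfl
      refine Finset.card_lt_card (Finset.filter_ssubset.2 ⟨g b₀, hgB b₀ hb₀, hfg b₀ hb₀⟩)
    · ext x
      simp only [Finset.mem_biUnion, Finset.mem_add, Finset.mem_union, Finset.mem_image,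
        Finset.mem_filter]
      constructor
      · rintro ⟨a, ha, b, hb, rfl⟩
        exact ⟨b, hb, a, Or.inl ha, b, ⟨hb, by simpa using hfA b hb⟩, rfl⟩
      · rintro ⟨b₀, hb₀, y, hy | ⟨b, hb, rfl⟩, z, ⟨hz, hz'⟩, rfl⟩
        · exact ⟨y, hy, z, hz, rfl⟩
        · exact ⟨_, hz', b, hb, by abel⟩

/-- Kneser's theorem. -/
theorem card_add_stab_add_card_add_stab_le {A B : Finset G} (hA : A.Nonempty) (hB : B.Nonempty) :
    (A + stabFinset (A + B)).card + (B + stabFinset (A + B)).card ≤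
      (A + B).card + (stabFinset (A + B)).card := by
  have hne : (stabFinset (A + B)).Nonempty := ⟨0, zero_mem_stabFinset (hA.add hB)⟩
  have h : A + stabFinset (A + B) + (B + stabFinset (A + B)) = A + B := by
    rw [add_add_add_comm, ← add_assoc, add_add_stabFinset hA hB, add_add_stabFinset hA hB]
  have := card_add_card_le_card_add_add_card_stab (hA.add hne) (hB.add hne)
  rwa [h] at this

/-! ### Representation counts -/

theorem rep_pos_iff {A B : Finset G} {g : G} : 0 < rep A B g ↔ g ∈ A + B := by
  rw [rep, Finset.card_pos, Finset.mem_add]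
  constructor
  · rintro ⟨⟨a, b⟩, h⟩
    rw [Finset.mem_filter, Finset.mem_product] at h
    exact ⟨a, h.1.1, b, h.1.2, h.2⟩
  · rintro ⟨a, ha, b, hb, h⟩
    exact ⟨(a, b), Finset.mem_filter.2 ⟨Finset.mem_product.2 ⟨ha, hb⟩, h⟩⟩

theorem mem_repSum {A B : Finset G} {g : G} {i : ℕ} (hi : 0 < i) :
    g ∈ repSum A B i ↔ i ≤ rep A B g := by
  rw [repSum, Finset.mem_filter, ← rep_pos_iff]
  exact ⟨And.right, fun h => ⟨hi.trans_le h, h⟩⟩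

theorem repSum_one (A B : Finset G) : repSum A B 1 = A + B := by
  ext g
  rw [mem_repSum one_pos, ← rep_pos_iff]
  exact Iff.rfl

theorem rep_comm (A B : Finset G) (g : G) : rep A B g = rep B A g := by
  refine Finset.card_bij (fun p _ => p.swap) ?_ (fun _ _ _ _ h => Prod.swap_injective h) ?_
  · rintro ⟨a, b⟩ h
    rw [Finset.mem_filter, Finset.mem_product] at h ⊢
    exact ⟨h.1.symm, (add_comm _ _).trans h.2⟩
  · rintro ⟨b, a⟩ h
    rw [Finset.mem_filter, Finset.mem_product] at h
    exact ⟨(a, b), Finset.mem_filter.2 ⟨Finset.mem_product.2 h.1.symm,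
      (add_comm _ _).trans h.2⟩, rfl⟩

theorem repSum_comm (A B : Finset G) (i : ℕ) : repSum A B i = repSum B A i := by
  simp only [repSum, rep_comm A B, add_comm A B]

theorem rep_mono {A B A' B' : Finset G} (hA : A' ⊆ A) (hB : B' ⊆ B) (g : G) :
    rep A' B' g ≤ rep A B g :=
  Finset.card_le_card (Finset.filter_subset_filter _ (Finset.product_subset_product hA hB))

theorem rep_lt_rep {A B A' B' : Finset G} (hA : A' ⊆ A) (hB : B' ⊆ B) {a b : G} (ha : a ∈ A)
    (hb : b ∈ B) (hab : a ∉ A' ∨ b ∉ B') : rep A' B' (a + b) < rep A B (a + b) := by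
  refine Finset.card_lt_card (Finset.ssubset_iff_of_subset
    (Finset.filter_subset_filter _ (Finset.product_subset_product hA hB)) |>.2
    ⟨(a, b), by simp [ha, hb], ?_⟩)
  rw [Finset.mem_filter, Finset.mem_product]
  tauto

theorem rep_insert_le (A B : Finset G) (a g : G) : rep (insert a A) B g ≤ rep A B g + 1 := by
  have h : ((insert a A) ×ˢ B).filter (fun p => p.1 + p.2 = g) ⊆
      insert (a, g - a) ((A ×ˢ B).filter (fun p => p.1 + p.2 = g)) := by
    rintro ⟨x, y⟩ h
    simp only [Finset.mem_filter, Finset.mem_product, Finset.mem_insert, Prod.mk.injEq] at h ⊢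
    obtain ⟨⟨rfl | hx, hy⟩, rfl⟩ := h
    · left; simp
    · right; exact ⟨⟨hx, hy⟩, rfl⟩
  exact (Finset.card_le_card h).trans (Finset.card_insert_le _ _)

theorem eq_of_rep_lt_two {A B : Finset G} {a b a' b' : G} (h : rep A B (a + b) < 2) (ha : a ∈ A)
    (hb : b ∈ B) (ha' : a' ∈ A) (hb' : b' ∈ B) (hab : a' + b' = a + b) : a' = a ∧ b' = b := by
  have := Finset.card_le_one.1 (Nat.le_of_lt_succ h) (a', b') (by simp [ha', hb', hab])
    (a, b) (by simp [ha, hb])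
  simpa using this

theorem exists_third_rep {A B : Finset G} {a b b₀ : G} (h : 2 < rep A B (a + b)) :
    ∃ a' ∈ A, ∃ b' ∈ B, a' + b' = a + b ∧ a' ≠ a ∧ b' ≠ b₀ := by
  by_contra! hcon
  have hsub : (A ×ˢ B).filter (fun p => p.1 + p.2 = a + b) ⊆ {(a, b), (a + b - b₀, b₀)} := by
    rintro ⟨x, y⟩ hxy
    simp only [Finset.mem_filter, Finset.mem_product, Finset.mem_insert, Finset.mem_singleton,
      Prod.mk.injEq] at hxy ⊢
    obtain ⟨⟨hx, hy⟩, hxy⟩ := hxy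
    by_cases hxa : x = a
    · subst hxa
      left; simpa using hxy
    · right
      have := hcon x hx y hy hxy hxa
      subst this
      exact ⟨by rw [← hxy]; abel, rfl⟩
  have h1 := Finset.card_le_card hsub
  have h2 := Finset.card_le_two (a := (a, b)) (b := (a + b - b₀, b₀))
  unfold rep at h
  omega

theorem rep_dyson_le (A B : Finset G) (e g : G) :
    rep (A.filter (fun a => e + a ∈ B)) (B ∪ A.image (e + ·)) g ≤ rep A B g := by
  refine Finset.card_le_card_of_injOn
    (fun p => if p.2 ∈ B then p else (p.2 - e, e + p.1)) ?_ ?_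
  · rintro ⟨x, y⟩ h
    simp only [Finset.coe_filter, Finset.mem_product, Finset.mem_filter, Finset.mem_union,
      Finset.mem_image, Set.mem_ofPred_eq] at h ⊢
    obtain ⟨⟨⟨hx, hx'⟩, hy⟩, rfl⟩ := h
    split_ifs with hyB
    · exact ⟨⟨hx, hyB⟩, rfl⟩
    · obtain ⟨z, hz, rfl⟩ := hy.resolve_left hyB
      refine ⟨⟨by simpa using hz, hx'⟩, by
        change e + z - e + (e + x) = x + (e + z)
        abel⟩
  · rintro ⟨x, y⟩ h ⟨x', y'⟩ h' heq
    simp only [Finset.coe_filter, Finset.mem_product, Finset.mem_filter, Set.mem_ofPred_eq] at h h'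
    dsimp only at heq
    split_ifs at heq with h1 h2 h2
    · exact heq
    · simp only [Prod.mk.injEq] at heq
      have := h.1.1.2
      rw [heq.1] at this
      exact absurd (by simpa using this) h2
    · simp only [Prod.mk.injEq] at heq
      have := h'.1.1.2
      rw [← heq.1] at this
      exact absurd (by simpa using this) h1
    · simp only [Prod.mk.injEq, sub_left_inj, add_right_inj] at heq
      rw [heq.1, heq.2]

/-! ### The Pollard sum `|A +₁ B| + |A +₂ B|` -/

/-- The sum `|A +₁ B| + |A +₂ B|`. -/
def pollardSum (A B : Finset G) : ℕ := (repSum A B 1).card + (repSum A B 2).card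

theorem pollardSum_comm (A B : Finset G) : pollardSum A B = pollardSum B A := by
  simp only [pollardSum, repSum_comm A B]

theorem pollardSum_add_card_le {A B A' B' T : Finset G} (h : ∀ g, rep A' B' g ≤ rep A B g)
    (hT : ∀ g ∈ T, rep A' B' g < 2 ∧ rep A' B' g < rep A B g) :
    pollardSum A' B' + T.card ≤ pollardSum A B := by
  have h1 : repSum A' B' 1 ∪ (T \ repSum A' B' 1) ⊆ repSum A B 1 := by
    intro g hg
    rw [mem_repSum one_pos]
    rw [Finset.mem_union, Finset.mem_sdiff, mem_repSum one_pos] at hg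
    rcases hg with hg | hg
    · exact hg.trans (h g)
    · have := (hT g hg.1).2; omega
  have h2 : repSum A' B' 2 ∪ (T ∩ repSum A' B' 1) ⊆ repSum A B 2 := by
    intro g hg
    rw [mem_repSum two_pos]
    rw [Finset.mem_union, Finset.mem_inter, mem_repSum one_pos, mem_repSum two_pos] at hg
    rcases hg with hg | hg
    · exact hg.trans (h g)
    · have := (hT g hg.1).2; omega
  have d2 : Disjoint (repSum A' B' 2) (T ∩ repSum A' B' 1) := by
    rw [Finset.disjoint_left]
    intro g hg hg'
    rw [mem_repSum two_pos] at hg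
    have := (hT g (Finset.mem_inter.1 hg').1).1
    omega
  have c1 := Finset.card_le_card h1
  have c2 := Finset.card_le_card h2
  rw [Finset.card_union_of_disjoint Finset.disjoint_sdiff] at c1
  rw [Finset.card_union_of_disjoint d2] at c2
  have c3 := Finset.card_sdiff_add_card_inter T (repSum A' B' 1)
  unfold pollardSum
  omega

/-- Every element of `A + B` has at least two representations. -/
def NoUnique (A B : Finset G) : Prop := ∀ a ∈ A, ∀ b ∈ B, 2 ≤ rep A B (a + b)

theorem NoUnique.symm {A B : Finset G} (h : NoUnique A B) : NoUnique B A := by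
  intro b hb a ha
  rw [rep_comm, add_comm]
  exact h a ha b hb

theorem NoUnique.two_le_rep {A B : Finset G} (h : NoUnique A B) {g : G} (hg : g ∈ A + B) :
    2 ≤ rep A B g := by
  obtain ⟨a, ha, b, hb, rfl⟩ := Finset.mem_add.1 hg
  exact h a ha b hb

theorem NoUnique.repSum_two {A B : Finset G} (h : NoUnique A B) : repSum A B 2 = A + B := by
  ext g
  rw [mem_repSum two_pos, ← rep_pos_iff]
  exact ⟨fun h => two_pos.trans_le h, fun hg => h.two_le_rep (rep_pos_iff.1 hg)⟩

theorem NoUnique.pollardSum_eq {A B : Finset G} (h : NoUnique A B) :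
    pollardSum A B = 2 * (A + B).card := by
  rw [pollardSum, h.repSum_two, repSum_one, two_mul]

theorem NoUnique.exists_add_notMem {A B : Finset G} (h : NoUnique A B) {a : G}
    (ha : ¬ NoUnique (insert a A) B) : ∃ b ∈ B, a + b ∉ A + B := by
  unfold NoUnique at ha
  push Not at ha
  obtain ⟨x, hx, b, hb, hlt⟩ := ha
  have hnot : x + b ∉ A + B := fun hmem => by
    have h1 := h.two_le_rep hmem
    have h2 := rep_mono (Finset.subset_insert a A) (Finset.Subset.refl B) (x + b)
    omega
  rcases Finset.mem_insert.1 hx with rfl | hx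
  · exact ⟨b, hb, hnot⟩
  · exact absurd (Finset.add_mem_add hx hb) hnot

/-! ### Consequences of Kneser's theorem -/

theorem subset_add_stabFinset {A B : Finset G} (hA : A.Nonempty) (hB : B.Nonempty)
    (S : Finset G) : S ⊆ S + stabFinset (A + B) := fun x hx =>
  Finset.mem_add.2 ⟨x, hx, 0, zero_mem_stabFinset (hA.add hB), add_zero x⟩

/-- The elements of `B` in the `H(C)`-coset of `b`. -/
def cosetPart (C B : Finset G) (b : G) : Finset G := B.filter (fun y => y - b ∈ stabFinset C)

theorem card_stab_add_card_le {A B : Finset G} (hA : A.Nonempty) {b : G}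
    (hb : b ∈ B) : (stabFinset (A + B)).card + B.card ≤
      (cosetPart (A + B) B b).card + (B + stabFinset (A + B)).card := by
  have hsub : (stabFinset (A + B)).image (b + ·) ⊆
      cosetPart (A + B) B b ∪ ((B + stabFinset (A + B)) \ B) := by
    intro x hx
    obtain ⟨h, hh, rfl⟩ := Finset.mem_image.1 hx
    by_cases hxB : b + h ∈ B
    · exact Finset.mem_union_left _ (Finset.mem_filter.2 ⟨hxB, by simpa using hh⟩)
    · exact Finset.mem_union_right _ (Finset.mem_sdiff.2 ⟨Finset.add_mem_add hb hh, hxB⟩)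
  have h1 := (Finset.card_le_card hsub).trans (Finset.card_union_le _ _)
  rw [Finset.card_image_of_injective _ (add_right_injective b)] at h1
  have hs := subset_add_stabFinset hA ⟨b, hb⟩ B
  rw [Finset.card_sdiff_of_subset hs] at h1
  have := Finset.card_le_card hs
  omega

theorem card_add_card_le_card_cosetPart {A B : Finset G} (hA : A.Nonempty) {b : G}
    (hb : b ∈ B) : A.card + B.card ≤ (A + B).card + (cosetPart (A + B) B b).card := by
  have h1 := card_stab_add_card_le hA hb
  have h2 := card_add_stab_add_card_add_stab_le hA ⟨b, hb⟩
  have h3 := Finset.card_le_card (subset_add_stabFinset hA ⟨b, hb⟩ A)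
  omega

theorem add_notMem_of_mem_cosetPart {C B : Finset G} (hC : C.Nonempty) {a b y : G}
    (hab : a + b ∉ C) (hy : y ∈ cosetPart C B b) : a + y ∉ C := by
  intro hmem
  have hst := (mem_stabFinset hC).1 (Finset.mem_filter.1 hy).2
  have : (y - b) + (a + b) ∈ C ↔ a + b ∈ C := AddAction.mem_stabilizer_finset.1 hst _
  rw [show (y - b) + (a + b) = a + y by abel] at this
  exact hab (this.1 hmem)

/-- The elements of `a + B` outside `C`. -/
def newLine (C B : Finset G) (a : G) : Finset G := B.image (a + ·) \ C

theorem mem_newLine {C B : Finset G} {a g : G} :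
    g ∈ newLine C B a ↔ (∃ b ∈ B, a + b = g) ∧ g ∉ C := by
  rw [newLine, Finset.mem_sdiff, Finset.mem_image]

theorem card_cosetPart_le_card_newLine {C B : Finset G} (hC : C.Nonempty) {a b : G}
    (hab : a + b ∉ C) : (cosetPart C B b).card ≤ (newLine C B a).card := by
  rw [← Finset.card_image_of_injective (cosetPart C B b) (add_right_injective a)]
  refine Finset.card_le_card fun x hx => ?_
  obtain ⟨y, hy, rfl⟩ := Finset.mem_image.1 hx
  exact mem_newLine.2 ⟨⟨y, (Finset.mem_filter.1 hy).1, rfl⟩, add_notMem_of_mem_cosetPart hC hab hy⟩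

theorem NoUnique.card_newLine {A B : Finset G} (h : NoUnique A B) (hA : A.Nonempty) {a : G}
    (ha : ¬ NoUnique (insert a A) B) :
    A.card + B.card ≤ (A + B).card + (newLine (A + B) B a).card := by
  obtain ⟨b, hb, hab⟩ := h.exists_add_notMem ha
  have h1 := card_add_card_le_card_cosetPart hA hb
  have h2 := card_cosetPart_le_card_newLine (B := B) (hA.add ⟨b, hb⟩) hab
  omega

theorem rep_eq_zero_of_notMem {A B : Finset G} {g : G} (h : g ∉ A + B) : rep A B g = 0 := by
  rw [← rep_pos_iff] at h
  omega

theorem NoUnique.pollardSum_insert_left {A B : Finset G} (h : NoUnique A B) {a : G}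
    (ha : a ∉ A) :
    2 * (A + B).card + (newLine (A + B) B a).card ≤ pollardSum (insert a A) B := by
  rw [← h.pollardSum_eq]
  refine pollardSum_add_card_le (rep_mono (Finset.subset_insert a A) (Finset.Subset.refl B)) ?_
  intro g hg
  obtain ⟨⟨b, hb, rfl⟩, hg⟩ := mem_newLine.1 hg
  refine ⟨by rw [rep_eq_zero_of_notMem hg]; omega, ?_⟩
  exact rep_lt_rep (Finset.subset_insert a A) (Finset.Subset.refl B) (Finset.mem_insert_self a A)
    hb (Or.inl ha)

theorem NoUnique.bound_insert_insert {A B : Finset G} (h : NoUnique A B) (hA : A.Nonempty)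
    {a a' : G} (ha : a ∉ A) (ha' : a' ∉ insert a A) (hn : ¬ NoUnique (insert a A) B)
    (hn' : ¬ NoUnique (insert a' A) B) :
    2 * A.card + 2 * B.card ≤ pollardSum (insert a' (insert a A)) B := by
  have h1 := h.card_newLine hA hn
  have h2 := h.card_newLine hA hn'
  have h3 := h.pollardSum_insert_left ha
  have h4 : pollardSum (insert a A) B + (newLine (A + B) B a').card ≤
      pollardSum (insert a' (insert a A)) B := by
    refine pollardSum_add_card_le (rep_mono (Finset.subset_insert _ _) (Finset.Subset.refl B)) ?_
    intro g hg
    obtain ⟨⟨b, hb, rfl⟩, hg⟩ := mem_newLine.1 hg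
    refine ⟨?_, rep_lt_rep (Finset.subset_insert _ _) (Finset.Subset.refl B)
      (Finset.mem_insert_self _ _) hb (Or.inl ha')⟩
    have := rep_insert_le A B a (a' + b)
    rw [rep_eq_zero_of_notMem hg] at this
    omega
  omega

theorem NoUnique.bound_insert_left_right {A B : Finset G} (h : NoUnique A B) (hA : A.Nonempty)
    (hB : B.Nonempty) {a b : G} (ha : a ∉ A) (hb : b ∉ B) (hn : ¬ NoUnique (insert a A) B)
    (hn' : ¬ NoUnique A (insert b B)) :
    2 * A.card + 2 * B.card ≤ pollardSum (insert a A) (insert b B) := by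
  have h1 := h.card_newLine hA hn
  have h2 := h.symm.card_newLine hB (fun h => hn' h.symm)
  have h3 := h.pollardSum_insert_left ha
  have h4 : pollardSum (insert a A) B + (newLine (B + A) A b).card ≤
      pollardSum (insert a A) (insert b B) := by
    refine pollardSum_add_card_le (rep_mono (Finset.Subset.refl _) (Finset.subset_insert _ _)) ?_
    intro g hg
    obtain ⟨⟨x, hx, rfl⟩, hg⟩ := mem_newLine.1 hg
    rw [add_comm b x]
    refine ⟨?_, rep_lt_rep (Finset.Subset.refl _) (Finset.subset_insert _ _)
      (Finset.mem_insert_of_mem hx) (Finset.mem_insert_self _ _) (Or.inr hb)⟩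
    have := rep_insert_le A B a (x + b)
    rw [add_comm B A, add_comm b x] at hg
    rw [rep_eq_zero_of_notMem hg] at this
    omega
  rw [add_comm B A] at h2 h4
  omega

/-! ### The lower bound for the Pollard sum -/

/-- Some pair obtained from `(A, B)` by removing at most one element has no unique expression
elements. -/
def HasCore (A B : Finset G) : Prop :=
  NoUnique A B ∨ (∃ a ∈ A, NoUnique (A.erase a) B) ∨ ∃ b ∈ B, NoUnique A (B.erase b)

/-- The dichotomy between the existence of a core and the lower bound for the Pollard sum. -/
def CoreOrBound (A B : Finset G) : Prop :=
  HasCore A B ∨ 2 * A.card + 2 * B.card ≤ pollardSum A B + 4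

theorem HasCore.symm {A B : Finset G} (h : HasCore A B) : HasCore B A := by
  rcases h with h | ⟨a, ha, h⟩ | ⟨b, hb, h⟩
  · exact Or.inl h.symm
  · exact Or.inr (Or.inr ⟨a, ha, h.symm⟩)
  · exact Or.inr (Or.inl ⟨b, hb, h.symm⟩)

theorem CoreOrBound.symm {A B : Finset G} (h : CoreOrBound A B) : CoreOrBound B A := by
  rcases h with h | h
  · exact Or.inl h.symm
  · right
    rw [pollardSum_comm]
    omega

theorem bound_of_card_eq_two {A B : Finset G} (hA : A.card = 2) :
    2 * A.card + 2 * B.card ≤ pollardSum A B + 4 := by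
  obtain ⟨a, a', hne, rfl⟩ := Finset.card_eq_two.1 hA
  have h0 : ∀ g, rep (∅ : Finset G) B g = 0 := fun g => by simp [rep]
  have h1 : pollardSum ∅ B + (B.image (a + ·)).card ≤ pollardSum {a} B := by
    refine pollardSum_add_card_le (fun g => by rw [h0]; exact Nat.zero_le _) ?_
    intro g hg
    obtain ⟨b, hb, rfl⟩ := Finset.mem_image.1 hg
    refine ⟨by rw [h0]; exact two_pos, ?_⟩
    exact rep_lt_rep (Finset.empty_subset _) (Finset.Subset.refl B) (Finset.mem_singleton_self a)
      hb (Or.inl (Finset.notMem_empty a))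
  have h2 : pollardSum {a} B + (B.image (a' + ·)).card ≤ pollardSum {a, a'} B := by
    refine pollardSum_add_card_le (rep_mono (by simp) (Finset.Subset.refl B)) ?_
    intro g hg
    obtain ⟨b, hb, rfl⟩ := Finset.mem_image.1 hg
    refine ⟨?_, rep_lt_rep (by simp) (Finset.Subset.refl B) (by simp) hb
      (Or.inl (by simpa using hne.symm))⟩
    have := rep_insert_le ∅ B a (a' + b)
    rw [h0] at this
    simpa using Nat.lt_succ_of_le this
  rw [Finset.card_image_of_injective _ (add_right_injective _)] at h1 h2
  omega

theorem pollardSum_erase_add_two_le {A B : Finset G} {a b b' : G} (ha : a ∈ A) (hb : b ∈ B)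
    (hb' : b' ∈ B) (hne : b ≠ b') (h : rep A B (a + b) ≤ 2) (h' : rep A B (a + b') ≤ 2) :
    pollardSum (A.erase a) B + 2 ≤ pollardSum A B := by
  have hc : ({a + b, a + b'} : Finset G).card = 2 := Finset.card_pair (by simpa using hne)
  rw [← hc]
  refine pollardSum_add_card_le (rep_mono (Finset.erase_subset a A) (Finset.Subset.refl B)) ?_
  have key : ∀ y ∈ B, rep A B (a + y) ≤ 2 →
      rep (A.erase a) B (a + y) < 2 ∧ rep (A.erase a) B (a + y) < rep A B (a + y) := by
    intro y hy hle
    have := rep_lt_rep (Finset.erase_subset a A) (Finset.Subset.refl B) ha hy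
      (Or.inl (Finset.notMem_erase a A))
    exact ⟨by omega, this⟩
  intro g hg
  rcases Finset.mem_insert.1 hg with rfl | hg
  · exact key b hb h
  · rw [Finset.mem_singleton.1 hg]
    exact key b' hb' h'

theorem coreOrBound_of_two_low {A B : Finset G} (hA : 3 ≤ A.card) (hB : 2 ≤ B.card) {a b b' : G}
    (ha : a ∈ A) (hb : b ∈ B) (hb' : b' ∈ B) (hne : b ≠ b') (h : rep A B (a + b) ≤ 2)
    (h' : rep A B (a + b') ≤ 2) (ih : CoreOrBound (A.erase a) B) : CoreOrBound A B := by
  by_contra hcon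
  rw [CoreOrBound, not_or] at hcon
  obtain ⟨hcore, hbound⟩ := hcon
  apply hbound
  have hcard : (A.erase a).card + 1 = A.card := Finset.card_erase_add_one ha
  rcases ih with (hu | ⟨a', ha', hu⟩ | ⟨y, hy, hu⟩) | hb2
  · exact absurd (Or.inr (Or.inl ⟨a, ha, hu⟩)) hcore
  · have hcard' : ((A.erase a).erase a').card + 1 = (A.erase a).card :=
      Finset.card_erase_add_one ha'
    have e1 : insert a' ((A.erase a).erase a') = A.erase a := Finset.insert_erase ha'
    have hm : a ∈ A.erase a' :=
      Finset.mem_erase.2 ⟨(Finset.ne_of_mem_erase ha').symm, ha⟩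
    have e2 : insert a ((A.erase a).erase a') = A.erase a' := by
      rw [Finset.erase_right_comm, Finset.insert_erase hm]
    have hfin := hu.bound_insert_insert (Finset.card_pos.1 (by omega)) (a := a') (a' := a)
      (Finset.notMem_erase _ _) (by rw [e1]; exact Finset.notMem_erase _ _)
      (by rw [e1]; exact fun hu' => hcore (Or.inr (Or.inl ⟨a, ha, hu'⟩)))
      (by rw [e2]; exact fun hu' =>
        hcore (Or.inr (Or.inl ⟨a', Finset.mem_of_mem_erase ha', hu'⟩)))
    rw [e1, Finset.insert_erase ha] at hfin
    omega
  · have hcard' : (B.erase y).card + 1 = B.card := Finset.card_erase_add_one hy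
    have hfin := hu.bound_insert_left_right (Finset.card_pos.1 (by omega))
      (Finset.card_pos.1 (by omega)) (a := a) (b := y) (Finset.notMem_erase _ _)
      (Finset.notMem_erase _ _)
      (by rw [Finset.insert_erase ha]; exact fun hu' => hcore (Or.inr (Or.inr ⟨y, hy, hu'⟩)))
      (by rw [Finset.insert_erase hy]; exact fun hu' => hcore (Or.inr (Or.inl ⟨a, ha, hu'⟩)))
    rw [Finset.insert_erase ha, Finset.insert_erase hy] at hfin
    omega
  · have := pollardSum_erase_add_two_le ha hb hb' hne h h'
    omega

theorem two_mul_card_add_le_pollardSum {A B C D : Finset G} {k : ℕ} (hC : C ⊆ repSum A B 2)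
    (hD : D ⊆ A + B) (hCD : Disjoint C D) (hk : D.card ≤ (D ∩ repSum A B 2).card + k) :
    2 * C.card + 2 * D.card ≤ pollardSum A B + k := by
  have h1 : C ∪ D ⊆ repSum A B 1 := by
    rw [repSum_one]
    exact Finset.union_subset (hC.trans (Finset.filter_subset _ _)) hD
  have h2 : C ∪ (D ∩ repSum A B 2) ⊆ repSum A B 2 :=
    Finset.union_subset hC Finset.inter_subset_right
  have c1 := Finset.card_le_card h1
  have c2 := Finset.card_le_card h2
  rw [Finset.card_union_of_disjoint hCD] at c1
  rw [Finset.card_union_of_disjoint (hCD.mono_right Finset.inter_subset_left)] at c2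
  unfold pollardSum
  omega

theorem coreOrBound_of_sparse {A B : Finset G} (hA : 3 ≤ A.card) (hB : 3 ≤ B.card)
    (hBA : B.card ≤ A.card)
    (hrow : ∀ a ∈ A, ∀ b ∈ B, ∀ b' ∈ B, b ≠ b' → rep A B (a + b) ≤ 2 → 2 < rep A B (a + b'))
    (hcol : ∀ b ∈ B, ∀ a ∈ A, ∀ a' ∈ A, a ≠ a' → rep A B (a + b) ≤ 2 → 2 < rep A B (a' + b))
    (ih : ∀ A' B' : Finset G, 2 ≤ A'.card → 2 ≤ B'.card → A'.card + B'.card = A.card + B.card →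
      min A'.card B'.card < min A.card B.card → CoreOrBound A' B') : CoreOrBound A B := by
  by_cases hu : NoUnique A B
  · exact Or.inl (Or.inl hu)
  right
  unfold NoUnique at hu
  push Not at hu
  obtain ⟨a₀, ha₀, b₀, hb₀, hlt⟩ := hu
  have huniq : ∀ a ∈ A, ∀ b ∈ B, a + b = a₀ + b₀ → a = a₀ ∧ b = b₀ :=
    fun a ha b hb hab => eq_of_rep_lt_two hlt ha₀ hb₀ ha hb hab
  obtain ⟨b, hb, hbne⟩ := Finset.exists_mem_ne (by omega : 1 < B.card) b₀
  obtain ⟨a', ha', b', hb', hab, ha'ne, hb'ne⟩ := exists_third_rep (b₀ := b₀)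
    (hrow a₀ ha₀ b₀ hb₀ b hb hbne.symm (by omega))
  set e := b' - a₀ with he
  set X := A.filter (fun x => e + x ∈ B) with hX
  set Y := B ∪ A.image (e + ·) with hY
  have ha₀X : a₀ ∈ X := by simp [hX, he, ha₀, hb']
  have ha'X : a' ∈ X := by
    rw [hX, Finset.mem_filter]
    refine ⟨ha', ?_⟩
    have : e + a' = b := by
      rw [he, show b' - a₀ + a' = a' + b' - a₀ by abel, hab]
      abel
    rwa [this]
  have hb₀Y : b₀ ∈ Y := Finset.mem_union_left _ hb₀
  have hX2 : 2 ≤ X.card := Finset.one_lt_card.2 ⟨a', ha'X, a₀, ha₀X, ha'ne⟩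
  have hXY : Y.card + X.card = B.card + A.card := dyson_card B A e
  have hXB : X.card < B.card := by
    rw [← Finset.card_image_of_injective X (add_right_injective e)]
    refine Finset.card_lt_card (Finset.ssubset_iff_of_subset ?_ |>.2 ⟨b₀, hb₀, ?_⟩)
    · intro x hx
      obtain ⟨y, hy, rfl⟩ := Finset.mem_image.1 hx
      exact (Finset.mem_filter.1 hy).2
    · intro hmem
      obtain ⟨y, hy, hyb⟩ := Finset.mem_image.1 hmem
      have hyA := (Finset.mem_filter.1 hy).1
      refine hb'ne (huniq y hyA b' hb' ?_).2
      rw [← hyb, he]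
      abel
  have hrep : ∀ g, rep X Y g ≤ rep A B g := rep_dyson_le A B e
  have huniq' : ∀ x ∈ X, ∀ y ∈ Y, x + y = a₀ + b₀ → x = a₀ ∧ y = b₀ :=
    fun x hx y hy hxy => eq_of_rep_lt_two ((hrep _).trans_lt hlt) ha₀X hb₀Y hx hy hxy
  rcases ih X Y hX2 (by omega) (by omega)
    (lt_min ((min_le_left _ _).trans_lt (by omega)) ((min_le_left _ _).trans_lt hXB)) with
    (hu | ⟨x, hx, hu⟩ | ⟨y, hy, hu⟩) | hbd
  · have h1 := hu a₀ ha₀X b₀ hb₀Y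
    have h2 := hrep (a₀ + b₀)
    omega
  · have hxa : x = a₀ := by
      by_contra hne
      have h1 := hu a₀ (Finset.mem_erase.2 ⟨Ne.symm hne, ha₀X⟩) b₀ hb₀Y
      have h2 := hrep (a₀ + b₀)
      have h3 := rep_mono (Finset.erase_subset x X) (Finset.Subset.refl Y) (a₀ + b₀)
      omega
    subst hxa
    have hcard : (X.erase x).card + 1 = X.card := Finset.card_erase_add_one hx
    have hne : (X.erase x).Nonempty := Finset.card_pos.1 (by omega)
    set C := X.erase x + Y with hC
    have hCne : C.Nonempty := hne.add ⟨b₀, hb₀Y⟩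
    have hnot : x + b₀ ∉ C := by
      intro hmem
      obtain ⟨z, hz, y, hy, hzy⟩ := Finset.mem_add.1 hmem
      exact Finset.ne_of_mem_erase hz (huniq' z (Finset.mem_of_mem_erase hz) y hy hzy).1
    have hK := card_add_card_le_card_cosetPart hne hb₀Y
    rw [← hC] at hK
    set D := (cosetPart C Y b₀).image (x + ·) with hD
    have hDcard : D.card = (cosetPart C Y b₀).card :=
      Finset.card_image_of_injective _ (add_right_injective x)
    have hCsub : C ⊆ repSum A B 2 := fun g hg => (mem_repSum two_pos).2 <|
      (hu.two_le_rep hg).trans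
        ((rep_mono (Finset.erase_subset x X) (Finset.Subset.refl Y) g).trans (hrep g))
    have hshift : ∀ z : G, x + (e + z) = z + b' := fun z => by rw [he]; abel
    have hDsub : D ⊆ A + B := by
      intro g hg
      obtain ⟨y, hy, rfl⟩ := Finset.mem_image.1 hg
      rcases Finset.mem_union.1 (Finset.mem_filter.1 hy).1 with hyB | hyA
      · exact Finset.add_mem_add ha₀ hyB
      · obtain ⟨z, hz, rfl⟩ := Finset.mem_image.1 hyA
        rw [hshift]
        exact Finset.add_mem_add hz hb'
    have hdisj : Disjoint C D := by
      rw [Finset.disjoint_right]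
      intro g hg
      obtain ⟨y, hy, rfl⟩ := Finset.mem_image.1 hg
      exact add_notMem_of_mem_cosetPart hCne hnot hy
    have hlow : (D \ repSum A B 2).card ≤ 2 := by
      have hsub : D \ repSum A B 2 ⊆
          insert (x + b₀) ((A.filter (fun a => rep A B (a + b') ≤ 2)).image (· + b')) := by
        intro g hg
        rw [Finset.mem_sdiff, mem_repSum two_pos] at hg
        obtain ⟨hg, hlow⟩ := hg
        obtain ⟨y, hy, rfl⟩ := Finset.mem_image.1 hg
        rcases Finset.mem_union.1 (Finset.mem_filter.1 hy).1 with hyB | hyA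
        · by_cases hyb : y = b₀
          · rw [hyb]; exact Finset.mem_insert_self _ _
          · have := hrow x ha₀ b₀ hb₀ y hyB (Ne.symm hyb) (by omega)
            omega
        · obtain ⟨z, hz, rfl⟩ := Finset.mem_image.1 hyA
          rw [hshift] at hlow ⊢
          exact Finset.mem_insert_of_mem (Finset.mem_image.2
            ⟨z, Finset.mem_filter.2 ⟨hz, by omega⟩, rfl⟩)
      have hone : (A.filter (fun a => rep A B (a + b') ≤ 2)).card ≤ 1 := by
        rw [Finset.card_le_one]
        intro u hu v hv
        rw [Finset.mem_filter] at hu hv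
        by_contra hne
        have := hcol b' hb' u hu.1 v hv.1 hne hu.2
        omega
      have h1 := (Finset.card_le_card hsub).trans (Finset.card_insert_le _ _)
      have h2 := Finset.card_image_le (s := A.filter (fun a => rep A B (a + b') ≤ 2))
        (f := (· + b'))
      omega
    have hsplit := Finset.card_sdiff_add_card_inter D (repSum A B 2)
    have := two_mul_card_add_le_pollardSum hCsub hDsub hdisj (k := 2) (by omega)
    omega
  · have hyb : y = b₀ := by
      by_contra hne
      have h1 := hu a₀ ha₀X b₀ (Finset.mem_erase.2 ⟨Ne.symm hne, hb₀Y⟩)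
      have h2 := hrep (a₀ + b₀)
      have h3 := rep_mono (Finset.Subset.refl X) (Finset.erase_subset y Y) (a₀ + b₀)
      omega
    subst hyb
    have hcard : (Y.erase y).card + 1 = Y.card := Finset.card_erase_add_one hy
    have hne : (Y.erase y).Nonempty := Finset.card_pos.1 (by omega)
    set C := Y.erase y + X with hC
    have hCne : C.Nonempty := hne.add ⟨a₀, ha₀X⟩
    have hnot : y + a₀ ∉ C := by
      intro hmem
      obtain ⟨z, hz, x, hx, hzx⟩ := Finset.mem_add.1 hmem
      refine Finset.ne_of_mem_erase hz (huniq' x hx z (Finset.mem_of_mem_erase hz) ?_).2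
      rw [add_comm, hzx, add_comm]
    have hK := card_add_card_le_card_cosetPart hne ha₀X
    rw [← hC] at hK
    set D := (cosetPart C X a₀).image (y + ·) with hD
    have hDcard : D.card = (cosetPart C X a₀).card :=
      Finset.card_image_of_injective _ (add_right_injective y)
    have hCsub : C ⊆ repSum A B 2 := fun g hg => (mem_repSum two_pos).2 <| by
      have h1 := hu.symm.two_le_rep hg
      rw [rep_comm] at h1
      exact h1.trans
        ((rep_mono (Finset.Subset.refl X) (Finset.erase_subset y Y) g).trans (hrep g))
    have hXA : ∀ x ∈ cosetPart C X a₀, x ∈ A := fun x hx =>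
      (Finset.mem_filter.1 (Finset.mem_filter.1 hx).1).1
    have hDsub : D ⊆ A + B := by
      intro g hg
      obtain ⟨x, hx, rfl⟩ := Finset.mem_image.1 hg
      exact Finset.mem_add.2 ⟨x, hXA x hx, y, hb₀, add_comm _ _⟩
    have hdisj : Disjoint C D := by
      rw [Finset.disjoint_right]
      intro g hg
      obtain ⟨x, hx, rfl⟩ := Finset.mem_image.1 hg
      exact add_notMem_of_mem_cosetPart hCne hnot hx
    have hlow : (D \ repSum A B 2).card ≤ 1 := by
      have hsub : D \ repSum A B 2 ⊆ {y + a₀} := by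
        intro g hg
        rw [Finset.mem_sdiff, mem_repSum two_pos] at hg
        obtain ⟨hg, hlow⟩ := hg
        obtain ⟨x, hx, rfl⟩ := Finset.mem_image.1 hg
        by_cases hxa : x = a₀
        · rw [hxa]; exact Finset.mem_singleton_self _
        · have := hcol y hb₀ a₀ ha₀ x (hXA x hx) (Ne.symm hxa) (by omega)
          rw [add_comm] at hlow
          omega
      simpa using Finset.card_le_card hsub
    have hsplit := Finset.card_sdiff_add_card_inter D (repSum A B 2)
    have := two_mul_card_add_le_pollardSum hCsub hDsub hdisj (k := 1) (by omega)
    omega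
  · have := pollardSum_add_card_le (T := ∅) hrep (by simp)
    rw [Finset.card_empty] at this
    omega

theorem coreOrBound_step {A B : Finset G} (hA : 2 ≤ A.card) (hB : 2 ≤ B.card)
    (hBA : B.card ≤ A.card)
    (ih : ∀ A' B' : Finset G, 2 ≤ A'.card → 2 ≤ B'.card → A'.card + B'.card < A.card + B.card →
      CoreOrBound A' B')
    (ih' : ∀ A' B' : Finset G, 2 ≤ A'.card → 2 ≤ B'.card → A'.card + B'.card = A.card + B.card →
      min A'.card B'.card < min A.card B.card → CoreOrBound A' B') : CoreOrBound A B := by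
  by_cases hA2 : A.card = 2
  · exact Or.inr (bound_of_card_eq_two hA2)
  by_cases hB2 : B.card = 2
  · exact CoreOrBound.symm (Or.inr (bound_of_card_eq_two hB2))
  by_contra hcon
  refine hcon (coreOrBound_of_sparse (by omega) (by omega) hBA ?_ ?_ ih')
  · intro a ha b hb b' hb' hne h
    by_contra! h'
    have hcard := Finset.card_erase_add_one ha
    exact hcon (coreOrBound_of_two_low (by omega) hB ha hb hb' hne h h'
      (ih _ _ (by omega) hB (by omega)))
  · intro b hb a ha a' ha' hne h
    by_contra! h'
    have hcard := Finset.card_erase_add_one hb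
    rw [rep_comm, add_comm] at h h'
    exact hcon (coreOrBound_of_two_low (by omega) hA hb ha ha' hne h h'
      (ih _ _ hA (by omega) (by omega)).symm).symm

theorem coreOrBound (A B : Finset G) (hA : 2 ≤ A.card) (hB : 2 ≤ B.card) : CoreOrBound A B := by
  induction hn : A.card + B.card using Nat.strong_induction_on generalizing A B with
  | _ n ihn =>
  subst hn
  induction hm : min A.card B.card using Nat.strong_induction_on generalizing A B with
  | _ m ihm =>
  subst hm
  have ih : ∀ A' B' : Finset G, 2 ≤ A'.card → 2 ≤ B'.card →
      A'.card + B'.card < A.card + B.card → CoreOrBound A' B' :=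
    fun A' B' hA' hB' hlt => ihn _ hlt A' B' hA' hB' rfl
  have ih' : ∀ A' B' : Finset G, 2 ≤ A'.card → 2 ≤ B'.card →
      A'.card + B'.card = A.card + B.card → min A'.card B'.card < min A.card B.card →
      CoreOrBound A' B' :=
    fun A' B' hA' hB' heq hlt => ihm _ hlt A' B' hA' hB' (by rwa [heq]) rfl
  rcases le_total B.card A.card with h | h
  · exact coreOrBound_step hA hB h ih ih'
  · refine (coreOrBound_step hB hA h (fun A' B' hA' hB' hlt => ih A' B' hA' hB' (by omega))
      (fun A' B' hA' hB' heq hlt => ih' A' B' hA' hB' (by omega) ?_)).symm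
    rwa [min_comm A.card]

/-! ### Pairs with a core -/

theorem NoUnique.repSum_two_insert_left {A B : Finset G} (h : NoUnique A B) (a : G) :
    repSum (insert a A) B 2 = A + B := by
  ext g
  rw [mem_repSum two_pos, ← rep_pos_iff]
  constructor
  · intro hg
    have := rep_insert_le A B a g
    omega
  · intro hg
    exact (h.two_le_rep (rep_pos_iff.1 hg)).trans
      (rep_mono (Finset.subset_insert a A) (Finset.Subset.refl B) g)

theorem NoUnique.bound_insert_left {A B : Finset G} (h : NoUnique A B) (hA : A.Nonempty) {a : G}
    (ha : a ∉ A) (hn : ¬ NoUnique (insert a A) B) :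
    A.card + B.card + (A + stabFinset (A + B)).card + (B + stabFinset (A + B)).card
      ≤ pollardSum (insert a A) B + (stabFinset (A + B)).card := by
  obtain ⟨b, hb, hab⟩ := h.exists_add_notMem hn
  have h1 := card_stab_add_card_le hA hb
  have h2 := card_cosetPart_le_card_newLine (B := B) (hA.add ⟨b, hb⟩) hab
  have h3 := card_add_stab_add_card_add_stab_le hA ⟨b, hb⟩
  have h4 := Finset.card_le_card (subset_add_stabFinset hA ⟨b, hb⟩ A)
  have h5 := h.pollardSum_insert_left ha
  omega

theorem natCard_coe_add_stab {A S : Finset G} (hS : S.Nonempty) :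
    Nat.card ↥((A : Set G) + (stab S : Set G)) = (A + stabFinset S).card := by
  rw [← coe_stabFinset hS, ← Finset.coe_add]
  exact Set.ncard_coe_finset _

theorem two_le_card_stabFinset {S : Finset G} (hS : S.Nonempty) (h : stab S ≠ ⊥) :
    2 ≤ (stabFinset S).card := by
  obtain ⟨⟨x, hx⟩, hne⟩ := AddSubgroup.ne_bot_iff_exists_ne_zero.1 h
  exact Finset.one_lt_card.2 ⟨x, (mem_stabFinset hS).2 hx, 0, zero_mem_stabFinset hS,
    fun h0 => hne (Subtype.ext h0)⟩

theorem dichotomy_of_core {A B A' B' : Finset G} (hA' : A' ⊆ A) (hB' : B' ⊆ B)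
    (hAne : A'.Nonempty) (hBne : B'.Nonempty) {l : ℕ} (hl : l = (A \ A').card + (B \ B').card)
    (hl1 : l ≤ 1) (hu : NoUnique A' B') (hsum : A' + B' = repSum A B 2)
    (hbd : (2 * A.card + 2 * B.card - (2 - l) * ((stabFinset (A' + B')).card -
      (((A' + stabFinset (A' + B')).card - A'.card : ℤ) +
        ((B' + stabFinset (A' + B')).card - B'.card))) - 2 * l : ℤ) ≤ pollardSum A B) :
    ((2 * A.card + 2 * B.card - 4 : ℤ) ≤
      ((repSum A B 1).card : ℤ) + ((repSum A B 2).card : ℤ)) ∨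
    ∃ A' ⊆ A, ∃ B' ⊆ B, ∃ (l : ℕ) (H : AddSubgroup G) (ρ : ℤ),
      l = (A \ A').card + (B \ B').card ∧
      H = stab (repSum A B 2) ∧
      ρ = ((Nat.card ↥((A' : Set G) + (H : Set G)) : ℤ) - A'.card)
          + ((Nat.card ↥((B' : Set G) + (H : Set G)) : ℤ) - B'.card) ∧
      l ≤ 1 ∧
      repSum A' B' 2 = A' + B' ∧
      A' + B' = repSum A B 2 ∧
      H ≠ ⊥ ∧
      ((2 * A.card + 2 * B.card - (2 - l) * ((Nat.card H : ℤ) - ρ) - 2 * l : ℤ) ≤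
        ((repSum A B 1).card : ℤ) + ((repSum A B 2).card : ℤ)) ∧
      ((2 * A.card + 2 * B.card - 2 * (Nat.card H : ℤ) : ℤ) ≤
        (2 * A.card + 2 * B.card - (2 - l) * ((Nat.card H : ℤ) - ρ) - 2 * l : ℤ)) := by
  have hne : (A' + B').Nonempty := hAne.add hBne
  have hα := Finset.card_le_card (subset_add_stabFinset hAne hBne A')
  have hβ := Finset.card_le_card (subset_add_stabFinset hAne hBne B')
  have hN : (pollardSum A B : ℤ) = ((repSum A B 1).card : ℤ) + ((repSum A B 2).card : ℤ) := by
    simp [pollardSum]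
  rw [hN] at hbd
  by_cases hbot : stab (A' + B') = ⊥
  · left
    have h1 : (stabFinset (A' + B')).card = 1 := by
      rw [← natCard_stab hne, hbot, AddSubgroup.card_bot]
    rw [h1] at hbd
    interval_cases l <;> push_cast at hbd <;> omega
  · right
    have h2 := two_le_card_stabFinset hne hbot
    refine ⟨A', hA', B', hB', l, stab (A' + B'), _, hl, by rw [hsum], rfl, hl1, hu.repSum_two,
      hsum, hbot, ?_, ?_⟩
    · rwa [natCard_coe_add_stab hne, natCard_coe_add_stab hne, natCard_stab hne]
    · rw [natCard_coe_add_stab hne, natCard_coe_add_stab hne, natCard_stab hne]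
      interval_cases l <;> push_cast <;> omega

theorem thm_main_t_eq_two (A B : Finset G) (hA : A.Nonempty) (hB : B.Nonempty)
    (hAt : 2 ≤ A.card) (hBt : 2 ≤ B.card) :
    ((2 * A.card + 2 * B.card - 4 : ℤ) ≤
      ((repSum A B 1).card : ℤ) + ((repSum A B 2).card : ℤ)) ∨
    ∃ A' ⊆ A, ∃ B' ⊆ B, ∃ (l : ℕ) (H : AddSubgroup G) (ρ : ℤ),
      l = (A \ A').card + (B \ B').card ∧
      H = stab (repSum A B 2) ∧
      ρ = ((Nat.card ↥((A' : Set G) + (H : Set G)) : ℤ) - A'.card)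
          + ((Nat.card ↥((B' : Set G) + (H : Set G)) : ℤ) - B'.card) ∧
      l ≤ 1 ∧
      repSum A' B' 2 = A' + B' ∧
      A' + B' = repSum A B 2 ∧
      H ≠ ⊥ ∧
      ((2 * A.card + 2 * B.card - (2 - l) * ((Nat.card H : ℤ) - ρ) - 2 * l : ℤ) ≤
        ((repSum A B 1).card : ℤ) + ((repSum A B 2).card : ℤ)) ∧
      ((2 * A.card + 2 * B.card - 2 * (Nat.card H : ℤ) : ℤ) ≤
        (2 * A.card + 2 * B.card - (2 - l) * ((Nat.card H : ℤ) - ρ) - 2 * l : ℤ)) := by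
  rcases coreOrBound A B hAt hBt with hcore | hbd
  swap
  · left
    unfold pollardSum at hbd
    omega
  by_cases hu : NoUnique A B
  · refine dichotomy_of_core (Finset.Subset.refl A) (Finset.Subset.refl B) hA hB (l := 0)
      (by simp) zero_le_one hu hu.repSum_two.symm ?_
    have h1 := card_add_stab_add_card_add_stab_le hA hB
    rw [hu.pollardSum_eq]
    push_cast
    omega
  rcases hcore with h | ⟨a, ha, h⟩ | ⟨b, hb, h⟩
  · exact absurd h hu
  · have hcard := Finset.card_erase_add_one ha
    have hne : (A.erase a).Nonempty := Finset.card_pos.1 (by omega)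
    have hins := Finset.insert_erase ha
    have hsum := h.repSum_two_insert_left a
    have hbd := h.bound_insert_left hne (Finset.notMem_erase a A) (by rwa [hins])
    rw [hins] at hsum hbd
    refine dichotomy_of_core (Finset.erase_subset a A) (Finset.Subset.refl B) hne hB (l := 1)
      ?_ le_rfl h hsum.symm ?_
    · have := Finset.card_sdiff_of_subset (Finset.erase_subset a A)
      rw [Finset.sdiff_self, Finset.card_empty]
      omega
    · push_cast
      omega
  · have hcard := Finset.card_erase_add_one hb
    have hne : (B.erase b).Nonempty := Finset.card_pos.1 (by omega)
    have hins := Finset.insert_erase hb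
    have hsum := h.symm.repSum_two_insert_left b
    have hbd := h.symm.bound_insert_left hne (Finset.notMem_erase b B)
      (by rw [hins]; exact fun hu' => hu hu'.symm)
    rw [hins, repSum_comm, add_comm (B.erase b)] at hsum
    rw [hins, pollardSum_comm, add_comm (B.erase b) A] at hbd
    refine dichotomy_of_core (Finset.Subset.refl A) (Finset.erase_subset b B) hA hne (l := 1)
      ?_ le_rfl h hsum.symm ?_
    · have := Finset.card_sdiff_of_subset (Finset.erase_subset b B)
      rw [Finset.sdiff_self, Finset.card_empty]
      omega
    · push_cast
      omega
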